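/- Let K be a field of characteristic zero, let a ∈ K be nonzero, and let E be the 3-dimensional Volterra evolution algebra over K with natural basis {e_1, e_2, e_3} and structural matrix [[0, 1, a], [−1, 0, 0], [−a, 0, 0]] (so e_1² = e_2 + a e_3, e_2² = −e_1, e_3² = −a e_1). If a³ + 1 ≠ 0, then every derivation of E is zero; if a³ + 1 = 0, then the derivations of E are exactly the linear maps D_α, α ∈ K, given by D_α(e_1) = 2α e_1, D_α(e_2) = α e_2 + 3aα e_3, D_α(e_3) = −3a²α e_2 + α e_3. -/

import Mathlib

open Matrix

/-- The product in the evolution algebra (on `Fin n → K`) whose structural matrix,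
relative to the natural basis of coordinate vectors, is `A`. -/
def evolMul {K : Type} [Field K] {n : ℕ} (A : Matrix (Fin n) (Fin n) K)
    (x y : Fin n → K) : Fin n → K :=
  fun k => ∑ i, x i * y i * A i k

theorem LinearMap.apply_eq_sum_smul_single_fin_three {K : Type} [Field K]
    (D : (Fin 3 → K) →ₗ[K] (Fin 3 → K)) (x : Fin 3 → K) :
    D x = x 0 • D (Pi.single 0 1) + x 1 • D (Pi.single 1 1) + x 2 • D (Pi.single 2 1) := by
  conv_lhs => rw [pi_eq_sum_univ' x, Fin.sum_univ_three]
  simp only [map_add, map_smul]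

/-- A derivation of the algebra is a `D_α`, where `α` must satisfy `α (a³ + 1) = 0`. -/
theorem exists_parameter_of_volterra_derivation {K : Type} [Field K] [CharZero K] {a : K}
    (ha : a ≠ 0) (D : (Fin 3 → K) →ₗ[K] (Fin 3 → K))
    (h : ∀ x y : Fin 3 → K,
      D (evolMul !![(0:K), 1, a; -1, 0, 0; -a, 0, 0] x y) =
        evolMul !![(0:K), 1, a; -1, 0, 0; -a, 0, 0] (D x) y +
          evolMul !![(0:K), 1, a; -1, 0, 0; -a, 0, 0] x (D y)) :
    ∃ α : K, α * (a ^ 3 + 1) = 0 ∧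
      D (Pi.single 0 1) = (2 * α) • (Pi.single 0 1 : Fin 3 → K) ∧
      D (Pi.single 1 1) =
        α • (Pi.single 1 1 : Fin 3 → K) + (3 * a * α) • (Pi.single 2 1 : Fin 3 → K) ∧
      D (Pi.single 2 1) =
        (-(3 * a ^ 2 * α)) • (Pi.single 1 1 : Fin 3 → K) +
          α • (Pi.single 2 1 : Fin 3 → K) := by
  have key (i j k : Fin 3) := congrFun (h (Pi.single i 1) (Pi.single j 1)) k
  simp only [LinearMap.apply_eq_sum_smul_single_fin_three D (evolMul _ _ _)] at key
  have h010 := key 0 1 0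
  have h011 := key 0 1 1
  have h020 := key 0 2 0
  have h021 := key 0 2 1
  have h120 := key 1 2 0
  have h001 := key 0 0 1
  have h002 := key 0 0 2
  have h110 := key 1 1 0
  have h220 := key 2 2 0
  simp [evolMul, Fin.sum_univ_three] at h010 h011 h020 h021 h120 h001 h002 h110 h220
  have d11 : D (Pi.single 0 1) 0 = 2 * D (Pi.single 1 1) 1 := by linear_combination -h110
  have d33 : D (Pi.single 2 1) 2 = D (Pi.single 1 1) 1 := by
    have : a * (2 * (D (Pi.single 2 1) 2 - D (Pi.single 1 1) 1)) = 0 := by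
      linear_combination h220 + a * d11
    simpa [ha, sub_eq_zero] using this
  clear h key h110 h220
  refine ⟨D (Pi.single 1 1) 1, by grind, ?_, ?_, ?_⟩ <;>
    ext k <;> fin_cases k <;> simp <;> grind

/-- let `K` have characteristic zero, `a ∈ K`, `a ≠ 0`, and let `E` be the
3-dimensional Volterra evolution algebra with structural matrix
`[[0,1,a],[−1,0,0],[−a,0,0]]` (`e₁² = e₂ + a e₃`, `e₂² = −e₁`, `e₃² = −a e₁`).
If `a³ + 1 ≠ 0` every derivation of `E` is zero; if `a³ + 1 = 0` the derivations of `E`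
are exactly the maps `D_α` with `D_α e₁ = 2α e₁`, `D_α e₂ = α e₂ + 3aα e₃`,
`D_α e₃ = −3a²α e₂ + α e₃`. -/
theorem derivations_of_three_dim_volterra_with_parameter
    {K : Type} [Field K] [CharZero K] (a : K) (ha : a ≠ 0) :
    ((a ^ 3 + 1 ≠ 0) →
      ∀ D : (Fin 3 → K) →ₗ[K] (Fin 3 → K),
        (∀ x y : Fin 3 → K,
            D (evolMul !![(0:K), 1, a; -1, 0, 0; -a, 0, 0] x y) =
              evolMul !![(0:K), 1, a; -1, 0, 0; -a, 0, 0] (D x) y +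
                evolMul !![(0:K), 1, a; -1, 0, 0; -a, 0, 0] x (D y)) →
        D = 0) ∧
    ((a ^ 3 + 1 = 0) →
      ∀ D : (Fin 3 → K) →ₗ[K] (Fin 3 → K),
        (∀ x y : Fin 3 → K,
            D (evolMul !![(0:K), 1, a; -1, 0, 0; -a, 0, 0] x y) =
              evolMul !![(0:K), 1, a; -1, 0, 0; -a, 0, 0] (D x) y +
                evolMul !![(0:K), 1, a; -1, 0, 0; -a, 0, 0] x (D y)) ↔
        (∃ α : K,
          D (Pi.single 0 1) = (2 * α) • (Pi.single 0 1 : Fin 3 → K) ∧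
          D (Pi.single 1 1) =
            α • (Pi.single 1 1 : Fin 3 → K) + (3 * a * α) • (Pi.single 2 1 : Fin 3 → K) ∧
          D (Pi.single 2 1) =
            (-(3 * a ^ 2 * α)) • (Pi.single 1 1 : Fin 3 → K) +
              α • (Pi.single 2 1 : Fin 3 → K))) := by
  refine ⟨fun hne D h => ?_, fun h0 D => ⟨fun h => ?_, ?_⟩⟩
  · obtain ⟨α, hα, h1, h2, h3⟩ := exists_parameter_of_volterra_derivation ha D h
    obtain rfl : α = 0 := (mul_eq_zero.mp hα).resolve_right hne
    refine LinearMap.ext fun x => ?_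
    rw [LinearMap.apply_eq_sum_smul_single_fin_three D x, h1, h2, h3]
    simp
  · obtain ⟨α, -, h⟩ := exists_parameter_of_volterra_derivation ha D h
    exact ⟨α, h⟩
  · rintro ⟨α, h1, h2, h3⟩ x y
    rw [LinearMap.apply_eq_sum_smul_single_fin_three D (evolMul _ _ _),
      LinearMap.apply_eq_sum_smul_single_fin_three D x,
      LinearMap.apply_eq_sum_smul_single_fin_three D y, h1, h2, h3]
    ext k
    fin_cases k <;> simp [evolMul, Fin.sum_univ_three] <;> grind
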